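/- For every fixed T > 0, lim_{σ₀→∞} (2·e^{−T/8}/(π^{3/2}·√T)) · ∫_0^∞ e^{−u²/(2T)} g(u; σ₀) du = 1. -/

import Mathlib

open scoped Real

/-- The SABR payoff function
`g(u; σ₀) = sinh u · ∫_0^u sin((σ₀/2) sinh s) / (sinh s · √(cosh u − cosh s)) ds`. -/
noncomputable def sabrPayoff (σ₀ u : ℝ) : ℝ :=
  Real.sinh u *
    ∫ s in (0 : ℝ)..u,
      Real.sin (σ₀ / 2 * Real.sinh s) /
        (Real.sinh s * Real.sqrt (Real.cosh u - Real.cosh s))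

open MeasureTheory Filter Topology Set

theorem tendsto_integral_sin_mul {f : ℝ → ℝ} (hf : Integrable f) :
    Tendsto (fun c : ℝ => ∫ x, Real.sin (c * x) * f x) atTop (𝓝 0) := by
  have h := Real.tendsto_integral_exp_smul_cocompact (fun x => (f x : ℂ))
  have hlim : Tendsto (fun c : ℝ => -(c / (2 * π))) atTop (cocompact ℝ) :=
    (tendsto_neg_atTop_atBot.comp (tendsto_id.atTop_div_const (by positivity))).mono_right
      atBot_le_cocompact
  have h2 := (Complex.continuous_im.tendsto 0).comp (h.comp hlim)
  rw [Complex.zero_im] at h2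
  refine h2.congr fun c => ?_
  have hi : Integrable (fun v : ℝ => Real.fourierChar (-(v * -(c / (2 * π)))) • (f v : ℂ)) := by
    simpa [mul_comm] using
      (Real.fourierIntegral_convergent_iff (f := fun v => (f v : ℂ)) (-(c / (2 * π)))).2 hf.ofReal
  simp only [Function.comp_apply]
  rw [← RCLike.im_eq_complex_im, ← integral_im hi]
  refine integral_congr_ae (.of_forall fun v => ?_)
  have : 2 * π * (v * (c / (2 * π))) = c * v := by field_simp
  simp only [Circle.smul_def, Real.fourierChar_apply, RCLike.im_eq_complex_im, smul_eq_mul]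
  rw [mul_neg, mul_neg, mul_neg, neg_neg, this, Complex.im_mul_ofReal, Complex.exp_ofReal_mul_I_im]

theorem tendsto_setIntegral_sin_mul_sinh_mul {f : ℝ → ℝ} {u : ℝ} (hu : 0 ≤ u)
    (hf : IntegrableOn f (Icc 0 u)) :
    Tendsto (fun c : ℝ => ∫ s in Icc 0 u, Real.sin (c * Real.sinh s) * f s) atTop (𝓝 0) := by
  set g : ℝ → ℝ := fun x => f (Real.arsinh x) / Real.cosh (Real.arsinh x) with hg
  have hcancel (s : ℝ) : Real.cosh s * g (Real.sinh s) = f s := by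
    simp only [hg, Real.arsinh_sinh]
    field_simp [(Real.cosh_pos s).ne']
  have hgi : IntegrableOn g (Icc (Real.sinh 0) (Real.sinh u)) := by
    rw [← integrableOn_Icc_deriv_smul_iff_of_deriv_nonneg
      Real.continuous_sinh.continuousOn (fun x _ => Real.hasDerivAt_sinh x)
      (fun x _ => (Real.cosh_pos x).le) hu]
    simpa only [smul_eq_mul, hcancel] using hf
  refine (tendsto_integral_sin_mul
    ((integrable_indicator_iff measurableSet_Icc).2 hgi)).congr fun c => ?_
  have := integral_Icc_deriv_smul_of_deriv_nonneg (g := fun x => Real.sin (c * x) * g x)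
      Real.continuous_sinh.continuousOn (fun x _ => Real.hasDerivAt_sinh x)
      (fun x _ => (Real.cosh_pos x).le) hu
  simp only [smul_eq_mul, mul_left_comm _ (Real.sin _), hcancel] at this
  rw [this, ← integral_indicator measurableSet_Icc]
  refine integral_congr_ae (.of_forall fun x => ?_)
  exact (indicator_mul_right _ (fun x => Real.sin (c * x)) g).symm

theorem integral_sin_odd_mul_div_sin (n : ℕ) :
    ∫ x in (0 : ℝ)..(π / 2), Real.sin ((2 * n + 1) * x) / Real.sin x = π / 2 ∧
    IntervalIntegrable (fun x => Real.sin ((2 * n + 1) * x) / Real.sin x) volume 0 (π / 2) := by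
  have hpi := Real.pi_pos
  induction n with
  | zero =>
    have h : EqOn (fun _ : ℝ => (1 : ℝ))
        (fun x => Real.sin ((2 * (0 : ℕ) + 1) * x) / Real.sin x) (uIoc 0 (π / 2)) := by
      intro x hx
      rw [uIoc_of_le (by positivity)] at hx
      have := Real.sin_pos_of_pos_of_lt_pi hx.1 (by linarith [hx.2])
      simp [this.ne']
    exact ⟨by rw [← intervalIntegral.integral_congr_ae (.of_forall h)]; simp,
      (intervalIntegrable_congr h).1 intervalIntegrable_const⟩
  | succ n ih =>
    have hc : Continuous fun x : ℝ => 2 * Real.cos ((2 * n + 2) * x) := by fun_prop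
    have h : EqOn (fun x : ℝ => Real.sin ((2 * n + 1) * x) / Real.sin x +
          2 * Real.cos ((2 * n + 2) * x))
        (fun x => Real.sin ((2 * (n + 1 : ℕ) + 1) * x) / Real.sin x) (uIoc 0 (π / 2)) := by
      intro x hx
      rw [uIoc_of_le (by positivity)] at hx
      have := Real.sin_pos_of_pos_of_lt_pi hx.1 (by linarith [hx.2])
      have h1 : (2 * (n : ℝ) + 1) * x = (2 * n + 2) * x - x := by ring
      have h2 : (2 * ((n + 1 : ℕ) : ℝ) + 1) * x = (2 * n + 2) * x + x := by push_cast; ring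
      simp only [h1, h2, Real.sin_sub, Real.sin_add]
      field_simp
      ring
    refine ⟨?_, (intervalIntegrable_congr h).1 (ih.2.add (hc.intervalIntegrable _ _))⟩
    rw [← intervalIntegral.integral_congr_ae (.of_forall h),
      intervalIntegral.integral_add ih.2 (hc.intervalIntegrable _ _), ih.1,
      intervalIntegral.integral_const_mul,
      intervalIntegral.integral_comp_mul_left (fun x => Real.cos x) (by positivity),
      integral_cos]
    have : (2 * (n : ℝ) + 2) * (π / 2) = ((n + 1 : ℕ) : ℝ) * π := by push_cast; ring
    rw [this, Real.sin_nat_mul_pi]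
    simp

theorem abs_inv_sin_sub_inv_le_one {x : ℝ} (hx : x ∈ Ioc 0 (π / 2)) :
    |1 / Real.sin x - 1 / x| ≤ 1 := by
  obtain ⟨h0, h1⟩ := hx
  have hs : 0 < Real.sin x := Real.sin_pos_of_pos_of_lt_pi h0 (by linarith [Real.pi_pos])
  have hc : 0 ≤ Real.cos x := Real.cos_nonneg_of_neg_pi_div_two_le_of_le (by linarith) h1
  have hle : 1 / x ≤ 1 / Real.sin x := one_div_le_one_div_of_le hs (Real.sin_lt h0).le
  have hge : Real.cos x / Real.sin x ≤ 1 / x := by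
    rcases h1.lt_or_eq with h1 | rfl
    · have hc' : 0 < Real.cos x := Real.cos_pos_of_mem_Ioo ⟨by linarith, h1⟩
      have := Real.lt_tan h0 h1
      rw [Real.tan_eq_sin_div_cos, lt_div_iff₀ hc'] at this
      rw [div_le_div_iff₀ hs h0]
      linarith
    · rw [Real.cos_pi_div_two, zero_div]
      positivity
  have htan : 1 / Real.sin x - Real.cos x / Real.sin x ≤ 1 := by
    rw [← sub_div, div_le_one hs]
    nlinarith [Real.sin_sq_add_cos_sq x, mul_nonneg hs.le hc]
  rw [abs_of_nonneg (by linarith)]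
  linarith

theorem tendsto_integral_sinc_odd_mul_pi_div_two :
    Tendsto (fun n : ℕ => ∫ x in (0 : ℝ)..((2 * n + 1) * (π / 2)), Real.sinc x)
      atTop (𝓝 (π / 2)) := by
  have hpi : (0 : ℝ) ≤ π / 2 := by positivity
  have hm : Measurable fun x : ℝ => 1 / Real.sin x - 1 / x := by fun_prop
  have hf : IntegrableOn (fun x : ℝ => 1 / Real.sin x - 1 / x) (Ioc 0 (π / 2)) :=
    Measure.integrableOn_of_bounded (M := 1) (by simp) hm.aestronglyMeasurable
      ((ae_restrict_mem measurableSet_Ioc).mono fun x hx => abs_inv_sin_sub_inv_le_one hx)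
  have hn : Tendsto (fun n : ℕ => 2 * (n : ℝ) + 1) atTop atTop :=
    tendsto_atTop_add_const_right _ _ (tendsto_natCast_atTop_atTop.const_mul_atTop two_pos)
  have h := (tendsto_integral_sin_mul
    ((integrable_indicator_iff measurableSet_Ioc).2 hf)).comp hn
  have h2 := h.const_sub (π / 2)
  rw [sub_zero] at h2
  refine h2.congr fun n => ?_
  have hsinc : Continuous fun x : ℝ => (2 * (n : ℝ) + 1) * Real.sinc ((2 * n + 1) * x) := by
    have := Real.continuous_sinc
    fun_prop
  have hd := integral_sin_odd_mul_div_sin n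
  have hint : ∫ x in (0 : ℝ)..((2 * n + 1) * (π / 2)), Real.sinc x
      = ∫ x in (0 : ℝ)..(π / 2), (2 * (n : ℝ) + 1) * Real.sinc ((2 * n + 1) * x) := by
    rw [intervalIntegral.integral_const_mul, intervalIntegral.mul_integral_comp_mul_left, mul_zero]
  have heq : ∫ x, Real.sin ((2 * n + 1) * x) *
        (Ioc 0 (π / 2)).indicator (fun x : ℝ => 1 / Real.sin x - 1 / x) x
      = ∫ x in (0 : ℝ)..(π / 2), (Real.sin ((2 * n + 1) * x) / Real.sin x -
          (2 * (n : ℝ) + 1) * Real.sinc ((2 * n + 1) * x)) := by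
    rw [intervalIntegral.integral_of_le hpi, ← integral_indicator measurableSet_Ioc]
    refine integral_congr_ae (.of_forall fun x => ?_)
    by_cases hx : x ∈ Ioc 0 (π / 2)
    · have hx0 : x ≠ 0 := hx.1.ne'
      have hn0 : 2 * (n : ℝ) + 1 ≠ 0 := by positivity
      simp only [indicator_of_mem hx, Real.sinc_of_ne_zero (mul_ne_zero hn0 hx0)]
      field_simp
    · simp [indicator_of_notMem hx]
  simp only [Function.comp_apply]
  rw [heq, intervalIntegral.integral_sub hd.2 (hsinc.intervalIntegrable _ _), hd.1, hint]
  ring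

theorem tendsto_integral_sinc_atTop :
    Tendsto (fun y : ℝ => ∫ x in (0 : ℝ)..y, Real.sinc x) atTop (𝓝 (π / 2)) := by
  have hpi := Real.pi_pos
  have hi (a b : ℝ) : IntervalIntegrable Real.sinc volume a b :=
    Real.continuous_sinc.intervalIntegrable a b
  have hfl : Tendsto (fun y : ℝ => ⌊y / π⌋₊) atTop atTop :=
    tendsto_nat_floor_atTop.comp (tendsto_id.atTop_div_const hpi)
  have h1 := tendsto_integral_sinc_odd_mul_pi_div_two.comp hfl
  have h2 : Tendsto (fun y : ℝ => (∫ x in (0 : ℝ)..y, Real.sinc x) -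
      ∫ x in (0 : ℝ)..((2 * (⌊y / π⌋₊ : ℝ) + 1) * (π / 2)), Real.sinc x) atTop (𝓝 0) := by
    have hb : Tendsto (fun y : ℝ => ((⌊y / π⌋₊ : ℝ))⁻¹) atTop (𝓝 0) :=
      (tendsto_inv_atTop_zero.comp tendsto_natCast_atTop_atTop).comp hfl
    refine squeeze_zero_norm' ?_ hb
    filter_upwards [hfl.eventually_ge_atTop 1, eventually_ge_atTop 0] with y hy hy0
    set n := ⌊y / π⌋₊
    have hn : (1 : ℝ) ≤ n := by exact_mod_cast hy
    have hl : n * π ≤ y := by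
      rw [← le_div_iff₀ hpi]; exact Nat.floor_le (by positivity)
    have hr : y ≤ (n + 1) * π := by
      rw [← div_le_iff₀ hpi]; exact (Nat.lt_floor_add_one _).le
    rw [intervalIntegral.integral_interval_sub_left (hi _ _) (hi _ _)]
    have hnp : 0 < n * π := by positivity
    refine (intervalIntegral.norm_integral_le_of_norm_le_const
      (C := (n * π)⁻¹) fun x hx => ?_).trans ?_
    · have hx' : n * π ≤ x := by
        refine le_trans (le_min ?_ hl) hx.1.le
        nlinarith
      have hx0 : 0 < x := hnp.trans_le hx'
      rw [Real.sinc_of_ne_zero hx0.ne', norm_div, Real.norm_eq_abs, Real.norm_eq_abs,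
        abs_of_pos hx0, inv_eq_one_div]
      exact div_le_div₀ zero_le_one (Real.abs_sin_le_one x) hnp hx'
    · have : |y - (2 * (n : ℝ) + 1) * (π / 2)| ≤ π := by
        rw [abs_le]; constructor <;> nlinarith
      calc (n * π)⁻¹ * |y - (2 * (n : ℝ) + 1) * (π / 2)| ≤ (n * π)⁻¹ * π := by gcongr
        _ = (n : ℝ)⁻¹ := by field_simp
  simpa using h2.add h1

theorem exists_abs_integral_sinc_le :
    ∃ C : ℝ, ∀ y : ℝ, 0 ≤ y → |∫ x in (0 : ℝ)..y, Real.sinc x| ≤ C := by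
  obtain ⟨Y, hY⟩ := eventually_atTop.1
    (tendsto_integral_sinc_atTop.abs.eventually_le_const (lt_add_one |π / 2|))
  refine ⟨max (|π / 2| + 1) Y, fun y hy => ?_⟩
  rcases le_total Y y with h | h
  · exact (hY y h).trans (le_max_left _ _)
  · have := intervalIntegral.norm_integral_le_of_norm_le_const (a := 0) (b := y) (C := 1)
      (f := Real.sinc) fun x _ => Real.abs_sinc_le_one x
    rw [sub_zero, abs_of_nonneg hy, one_mul] at this
    exact (this.trans h).trans (le_max_right _ _)

/-- The remainder left over when `1 / √(cosh u - cosh s)` is replaced by a multiple of `cosh s`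
in the integrand of `sabrPayoff`. -/
noncomputable def sabrRemainder (u s : ℝ) : ℝ :=
  (1 / √(Real.cosh u - Real.cosh s) - 1 / √(Real.cosh u - 1) * Real.cosh s) / Real.sinh s

theorem measurable_sabrRemainder (u : ℝ) : Measurable (sabrRemainder u) := by
  unfold sabrRemainder
  fun_prop

theorem abs_sabrRemainder_le {u s : ℝ} (hs : s ∈ Ioo 0 u) :
    |sabrRemainder u s| ≤ Real.sinh s / (2 * √(Real.cosh u - Real.cosh s)) / (Real.cosh u - 1) +
      1 / √(Real.cosh u - 1) := by
  obtain ⟨h0, hu⟩ := hs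
  have hsh : 0 < Real.sinh s := Real.sinh_pos_iff.2 h0
  have hc1 : 1 < Real.cosh s := Real.one_lt_cosh.2 h0.ne'
  have hcu : Real.cosh s < Real.cosh u := by
    rw [Real.cosh_lt_cosh, abs_of_pos h0, abs_of_pos (h0.trans hu)]; exact hu
  have hsq : Real.cosh s ^ 2 - Real.sinh s ^ 2 = 1 := Real.cosh_sq_sub_sinh_sq s
  unfold sabrRemainder
  set a := √(Real.cosh u - Real.cosh s) with ha
  set b := √(Real.cosh u - 1) with hb
  have ha0 : 0 < a := Real.sqrt_pos.2 (by linarith)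
  have hb0 : 0 < b := Real.sqrt_pos.2 (by linarith)
  have ha2 : a ^ 2 = Real.cosh u - Real.cosh s := Real.sq_sqrt (by linarith)
  have hb2 : b ^ 2 = Real.cosh u - 1 := Real.sq_sqrt (by linarith)
  have hab : a ≤ b := Real.sqrt_le_sqrt (by linarith)
  have hsplit : (1 / a - 1 / b * Real.cosh s) / Real.sinh s =
      (1 / a - 1 / b) / Real.sinh s - 1 / b * ((Real.cosh s - 1) / Real.sinh s) := by ring
  have e1 : 0 ≤ (1 / a - 1 / b) / Real.sinh s :=
    div_nonneg (sub_nonneg.2 (one_div_le_one_div_of_le ha0 hab)) hsh.le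
  have e2 : (1 / a - 1 / b) / Real.sinh s ≤ Real.sinh s / (2 * a) / (Real.cosh u - 1) := by
    have hle : 1 / a - 1 / b ≤ (b ^ 2 - a ^ 2) / (a * b ^ 2) := by
      rw [div_sub_div _ _ ha0.ne' hb0.ne', div_le_div_iff₀ (by positivity) (by positivity)]
      have : 0 ≤ (b - a) * a * (a * b ^ 2) :=
        mul_nonneg (mul_nonneg (sub_nonneg.2 hab) ha0.le) (by positivity)
      nlinarith
    rw [div_le_iff₀ hsh]
    refine hle.trans ?_
    rw [← hb2, div_mul_eq_mul_div, div_mul_eq_mul_div, div_div,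
      div_le_div_iff₀ (by positivity) (by positivity)]
    have : 2 * (b ^ 2 - a ^ 2) ≤ Real.sinh s * Real.sinh s := by nlinarith
    have hp : 0 < a * b ^ 2 := by positivity
    nlinarith [mul_le_mul_of_nonneg_right this hp.le]
  have e3 : 0 ≤ 1 / b * ((Real.cosh s - 1) / Real.sinh s) :=
    mul_nonneg (by positivity) (div_nonneg (by linarith) hsh.le)
  have e4 : 1 / b * ((Real.cosh s - 1) / Real.sinh s) ≤ 1 / b := by
    refine mul_le_of_le_one_right (by positivity) ?_
    rw [div_le_one hsh]
    nlinarith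
  have e5 : 0 < 1 / b := by positivity
  rw [hsplit, abs_le]
  constructor <;> linarith

theorem integrableOn_sinh_div_sqrt {u : ℝ} (hu : 0 < u) :
    IntegrableOn (fun s => Real.sinh s / (2 * √(Real.cosh u - Real.cosh s))) (Ioc 0 u) ∧
    ∫ s in Ioc 0 u, Real.sinh s / (2 * √(Real.cosh u - Real.cosh s)) = √(Real.cosh u - 1) := by
  have hcont : ContinuousOn (fun s => -√(Real.cosh u - Real.cosh s)) (Icc 0 u) := by fun_prop
  have hderiv : ∀ s ∈ Ioo 0 u, HasDerivAt (fun s => -√(Real.cosh u - Real.cosh s))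
      (Real.sinh s / (2 * √(Real.cosh u - Real.cosh s))) s := by
    intro s hs
    have hcu : Real.cosh s < Real.cosh u := by
      rw [Real.cosh_lt_cosh, abs_of_pos hs.1, abs_of_pos hu]; exact hs.2
    convert! (((Real.hasDerivAt_cosh s).const_sub (Real.cosh u)).sqrt
      (sub_pos.2 hcu).ne').neg using 1
    ring
  have hint := intervalIntegral.integrableOn_deriv_of_nonneg hcont hderiv fun s hs =>
    div_nonneg (Real.sinh_nonneg_iff.2 hs.1.le) (by positivity)
  refine ⟨hint, ?_⟩
  rw [← intervalIntegral.integral_of_le hu.le,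
    intervalIntegral.integral_eq_sub_of_hasDerivAt_of_le hu.le hcont hderiv
      ((intervalIntegrable_iff_integrableOn_Ioc_of_le hu.le).2 hint)]
  simp

theorem integrableOn_sabrRemainder {u : ℝ} (hu : 0 < u) :
    IntegrableOn (sabrRemainder u) (Ioc 0 u) ∧
    ∫ s in Ioc 0 u, |sabrRemainder u s| ≤ (1 + u) / √(Real.cosh u - 1) := by
  obtain ⟨hi, hv⟩ := integrableOn_sinh_div_sqrt hu
  have hc : IntegrableOn (fun _ : ℝ => 1 / √(Real.cosh u - 1)) (Ioc 0 u) :=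
    integrableOn_const (by simp)
  have hM := (hi.div_const (Real.cosh u - 1)).add hc
  have hle : ∀ᵐ s ∂volume.restrict (Ioc 0 u), ‖sabrRemainder u s‖ ≤
      Real.sinh s / (2 * √(Real.cosh u - Real.cosh s)) / (Real.cosh u - 1) +
      1 / √(Real.cosh u - 1) := by
    rw [← restrict_Ioo_eq_restrict_Ioc]
    exact (ae_restrict_mem measurableSet_Ioo).mono fun s hs => abs_sabrRemainder_le hs
  have hR : IntegrableOn (sabrRemainder u) (Ioc 0 u) :=
    Integrable.mono' hM (measurable_sabrRemainder u).aestronglyMeasurable hle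
  refine ⟨hR, (integral_mono_ae hR.norm hM hle).trans_eq ?_⟩
  have hpos : 0 < Real.cosh u - 1 := sub_pos.2 (Real.one_lt_cosh.2 hu.ne')
  rw [integral_add' (hi.div_const _) hc, integral_div, hv]
  simp only [setIntegral_const, smul_eq_mul, measureReal_def, Real.volume_Ioc, sub_zero,
    ENNReal.toReal_ofReal hu.le]
  have hb0 : 0 < √(Real.cosh u - 1) := Real.sqrt_pos.2 hpos
  nth_rewrite 2 [← Real.sq_sqrt hpos.le]
  field_simp

theorem integral_sin_mul_sinh_eq (c : ℝ) {u : ℝ} (hu : 0 < u) :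
    ∫ s in (0 : ℝ)..u, Real.sin (c * Real.sinh s) /
        (Real.sinh s * √(Real.cosh u - Real.cosh s)) =
      1 / √(Real.cosh u - 1) * (∫ x in (0 : ℝ)..(c * Real.sinh u), Real.sinc x) +
        ∫ s in Ioc 0 u, Real.sin (c * Real.sinh s) * sabrRemainder u s := by
  have hsinc := Real.continuous_sinc
  have hcont : Continuous fun s => Real.sinc (c * Real.sinh s) * (c * Real.cosh s) := by fun_prop
  have hsub : ∫ x in (0 : ℝ)..(c * Real.sinh u), Real.sinc x =
      ∫ s in Ioc 0 u, Real.sinc (c * Real.sinh s) * (c * Real.cosh s) := by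
    rw [← intervalIntegral.integral_of_le hu.le]
    have := intervalIntegral.integral_comp_mul_deriv (a := 0) (b := u)
      (f := fun s => c * Real.sinh s) (f' := fun s => c * Real.cosh s) (g := Real.sinc)
      (fun s _ => (Real.hasDerivAt_sinh s).const_mul c) (by fun_prop) hsinc
    simpa using this.symm
  have hi : IntegrableOn (fun s => Real.sinc (c * Real.sinh s) * (c * Real.cosh s)) (Ioc 0 u) :=
    (hcont.integrableOn_Icc).mono_set Ioc_subset_Icc_self
  have hR : IntegrableOn (fun s => Real.sin (c * Real.sinh s) * sabrRemainder u s) (Ioc 0 u) :=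
    (integrableOn_sabrRemainder hu).1.bdd_mul (c := 1) (by fun_prop)
      (.of_forall fun s => Real.abs_sin_le_one _)
  rw [hsub, ← integral_const_mul, ← integral_add (hi.const_mul _) hR,
    intervalIntegral.integral_of_le hu.le]
  refine setIntegral_congr_fun measurableSet_Ioc fun s hs => ?_
  have hsh : Real.sinh s ≠ 0 := (Real.sinh_pos_iff.2 hs.1).ne'
  have hmain : Real.sinc (c * Real.sinh s) * (c * Real.cosh s) =
      Real.sin (c * Real.sinh s) * (Real.cosh s / Real.sinh s) := by
    rcases eq_or_ne c 0 with rfl | hc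
    · simp
    · rw [Real.sinc_of_ne_zero (mul_ne_zero hc hsh)]
      field_simp
  simp only [hmain, sabrRemainder]
  rw [← div_div, div_right_comm, div_eq_mul_one_div _ √(Real.cosh u - Real.cosh s)]
  ring

theorem sinh_div_sqrt_cosh_sub_one {u : ℝ} (hu : 0 < u) :
    Real.sinh u * (1 / √(Real.cosh u - 1)) = √2 * Real.cosh (u / 2) := by
  have h1 : Real.sinh u = 2 * Real.sinh (u / 2) * Real.cosh (u / 2) := by
    rw [← Real.sinh_two_mul]; ring_nf
  have h2 : Real.cosh u - 1 = 2 * Real.sinh (u / 2) ^ 2 := by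
    have := Real.cosh_two_mul (u / 2)
    rw [mul_div_cancel₀ u two_ne_zero, Real.cosh_sq] at this
    linarith
  have hs : 0 < Real.sinh (u / 2) := Real.sinh_pos_iff.2 (by positivity)
  rw [h2, Real.sqrt_mul two_pos.le, Real.sqrt_sq hs.le, h1]
  have := Real.sq_sqrt (two_pos (α := ℝ)).le
  have h3 : 0 < √(2 : ℝ) := by positivity
  field_simp
  rw [this]

theorem sabrPayoff_eq (σ₀ : ℝ) {u : ℝ} (hu : 0 < u) :
    sabrPayoff σ₀ u =
      √2 * Real.cosh (u / 2) * (∫ x in (0 : ℝ)..(σ₀ / 2 * Real.sinh u), Real.sinc x) +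
        Real.sinh u * ∫ s in Ioc 0 u, Real.sin (σ₀ / 2 * Real.sinh s) * sabrRemainder u s := by
  rw [sabrPayoff, integral_sin_mul_sinh_eq _ hu, mul_add, ← mul_assoc,
    sinh_div_sqrt_cosh_sub_one hu]

theorem tendsto_sabrPayoff {u : ℝ} (hu : 0 < u) :
    Tendsto (fun σ₀ => sabrPayoff σ₀ u) atTop (𝓝 (√2 * Real.cosh (u / 2) * (π / 2))) := by
  have hsh : 0 < Real.sinh u := Real.sinh_pos_iff.2 hu
  have hhalf : Tendsto (fun σ₀ : ℝ => σ₀ / 2) atTop atTop := tendsto_id.atTop_div_const two_pos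
  have h1 := (tendsto_integral_sinc_atTop.comp (hhalf.atTop_mul_const hsh)).const_mul
    (√2 * Real.cosh (u / 2))
  have h2 := ((tendsto_setIntegral_sin_mul_sinh_mul hu.le
    ((integrableOn_Icc_iff_integrableOn_Ioc (by finiteness)).2 (integrableOn_sabrRemainder hu).1)).comp
      hhalf).const_mul (Real.sinh u)
  have h := h1.add h2
  rw [mul_zero, add_zero] at h
  refine h.congr fun σ₀ => ?_
  simp only [Function.comp_apply]
  rw [sabrPayoff_eq _ hu, integral_Icc_eq_integral_Ioc]

theorem exists_abs_sabrPayoff_le :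
    ∃ C : ℝ, ∀ σ₀ u : ℝ, 0 ≤ σ₀ → 0 < u → |sabrPayoff σ₀ u| ≤ C * Real.exp (3 / 2 * u) := by
  obtain ⟨C, hC⟩ := exists_abs_integral_sinc_le
  have hC0 : 0 ≤ C := (abs_nonneg _).trans (hC 0 le_rfl)
  refine ⟨√2 * (C + 1), fun σ₀ u hσ hu => ?_⟩
  have hsh : 0 < Real.sinh u := Real.sinh_pos_iff.2 hu
  obtain ⟨hi, hb⟩ := integrableOn_sabrRemainder hu
  have hR : |∫ s in Ioc 0 u, Real.sin (σ₀ / 2 * Real.sinh s) * sabrRemainder u s| ≤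
      (1 + u) * (1 / √(Real.cosh u - 1)) := by
    rw [mul_one_div, ← Real.norm_eq_abs]
    refine (norm_integral_le_of_norm_le hi.norm (.of_forall fun s => ?_)).trans hb
    rw [norm_mul]
    exact mul_le_of_le_one_left (norm_nonneg _) (Real.abs_sin_le_one _)
  have hcosh : Real.cosh (u / 2) ≤ Real.exp (u / 2) := by
    rw [Real.cosh_eq]
    have : Real.exp (-(u / 2)) ≤ Real.exp (u / 2) := Real.exp_le_exp.2 (by linarith)
    linarith
  have hexp : 1 + u ≤ Real.exp u := by linarith [Real.add_one_le_exp u]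
  have hcp := Real.cosh_pos (u / 2)
  calc |sabrPayoff σ₀ u|
      ≤ √2 * Real.cosh (u / 2) * C +
          Real.sinh u * ((1 + u) * (1 / √(Real.cosh u - 1))) := by
        rw [sabrPayoff_eq _ hu]
        refine (abs_add_le _ _).trans (add_le_add ?_ ?_)
        · rw [abs_mul, abs_of_pos (by positivity : 0 < √2 * Real.cosh (u / 2))]
          gcongr
          exact hC _ (by positivity)
        · rw [abs_mul, abs_of_pos hsh]
          gcongr
    _ = √2 * Real.cosh (u / 2) * (C + (1 + u)) := by
        rw [mul_left_comm, sinh_div_sqrt_cosh_sub_one hu]; ring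
    _ ≤ √2 * Real.exp (u / 2) * ((C + 1) * Real.exp u) := by
        gcongr
        nlinarith [Real.one_le_exp hu.le]
    _ = √2 * (C + 1) * Real.exp (3 / 2 * u) := by
        rw [show 3 / 2 * u = u / 2 + u by ring, Real.exp_add]; ring

theorem aestronglyMeasurable_sabrPayoff (σ₀ : ℝ) :
    AEStronglyMeasurable (sabrPayoff σ₀) (volume.restrict (Ioi 0)) := by
  have hm : Measurable fun p : ℝ × ℝ => {p : ℝ × ℝ | 0 < p.2 ∧ p.2 ≤ p.1}.indicator
      (fun p => Real.sin (σ₀ / 2 * Real.sinh p.2) /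
        (Real.sinh p.2 * √(Real.cosh p.1 - Real.cosh p.2))) p := by
    refine Measurable.indicator (by fun_prop) ?_
    exact (measurableSet_lt measurable_const measurable_snd).inter
      (measurableSet_le measurable_snd measurable_fst)
  have hI := hm.stronglyMeasurable.integral_prod_right' (ν := volume)
  refine ((Real.measurable_sinh.stronglyMeasurable.mul hI).aestronglyMeasurable).congr ?_
  filter_upwards [ae_restrict_mem measurableSet_Ioi] with u hu
  simp only [sabrPayoff, Pi.mul_apply]
  rw [intervalIntegral.integral_of_le (le_of_lt hu), ← integral_indicator measurableSet_Ioc]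
  rfl

theorem exp_neg_sq_div_mul_exp {T : ℝ} (hT : 0 < T) (a u : ℝ) :
    Real.exp (-u ^ 2 / (2 * T)) * Real.exp (a * u) =
      Real.exp (-(1 / (2 * T)) * (u - a * T) ^ 2) * Real.exp (a ^ 2 * T / 2) := by
  rw [← Real.exp_add, ← Real.exp_add]
  congr 1
  field_simp
  ring

theorem integrable_exp_neg_sq_div_mul_exp {T : ℝ} (hT : 0 < T) (a : ℝ) :
    Integrable fun u : ℝ => Real.exp (-u ^ 2 / (2 * T)) * Real.exp (a * u) := by
  have hb : 0 < 1 / (2 * T) := by positivity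
  simp only [exp_neg_sq_div_mul_exp hT]
  exact ((integrable_exp_neg_mul_sq hb).comp_sub_right (a * T)).mul_const _

theorem integral_exp_neg_sq_div_mul_exp {T : ℝ} (hT : 0 < T) (a : ℝ) :
    ∫ u : ℝ, Real.exp (-u ^ 2 / (2 * T)) * Real.exp (a * u) =
      √(2 * π * T) * Real.exp (a ^ 2 * T / 2) := by
  simp only [exp_neg_sq_div_mul_exp hT]
  rw [integral_mul_const,
    integral_sub_right_eq_self (fun u => Real.exp (-(1 / (2 * T)) * u ^ 2)), integral_gaussian]
  congr 2
  field_simp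

theorem integral_exp_neg_sq_div_mul_cosh {T : ℝ} (hT : 0 < T) (a : ℝ) :
    ∫ u in Ioi (0 : ℝ), Real.exp (-u ^ 2 / (2 * T)) * Real.cosh (a * u) =
      √(2 * π * T) / 2 * Real.exp (a ^ 2 * T / 2) := by
  have habs := integral_comp_abs
    (f := fun u => Real.exp (-u ^ 2 / (2 * T)) * Real.cosh (a * u))
  have heq : (fun u : ℝ => Real.exp (-|u| ^ 2 / (2 * T)) * Real.cosh (a * |u|)) =
      fun u => (Real.exp (-u ^ 2 / (2 * T)) * Real.exp (a * u) +
        Real.exp (-u ^ 2 / (2 * T)) * Real.exp (-a * u)) / 2 := by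
    funext u
    have : Real.cosh (a * |u|) = Real.cosh (a * u) := by
      rw [← Real.cosh_abs, abs_mul, abs_abs, ← abs_mul, Real.cosh_abs]
    rw [sq_abs, this, Real.cosh_eq, neg_mul]
    ring
  rw [heq, integral_div, integral_add (integrable_exp_neg_sq_div_mul_exp hT a)
    (integrable_exp_neg_sq_div_mul_exp hT (-a)), integral_exp_neg_sq_div_mul_exp hT,
    integral_exp_neg_sq_div_mul_exp hT, neg_sq] at habs
  linarith

/-- For fixed `T > 0`, the normalized at-the-money SABR option time value
`(2 e^(−T/8)/(π^(3/2) √T)) ∫_0^∞ e^(−u²/(2T)) g(u; σ₀) du` tends to `1` as `σ₀ → ∞`. -/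
theorem sabr_atm_value_tendsto_one (T : ℝ) (hT : 0 < T) :
    Filter.Tendsto
      (fun σ₀ : ℝ =>
        2 * Real.exp (-T / 8) / (π ^ (3 / 2 : ℝ) * Real.sqrt T) *
          ∫ u in Set.Ioi (0 : ℝ), Real.exp (-u ^ 2 / (2 * T)) * sabrPayoff σ₀ u)
      Filter.atTop (nhds 1) := by
  obtain ⟨C, hC⟩ := exists_abs_sabrPayoff_le
  have hlim : Tendsto (fun σ₀ : ℝ =>
        ∫ u in Ioi (0 : ℝ), Real.exp (-u ^ 2 / (2 * T)) * sabrPayoff σ₀ u) atTop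
      (𝓝 (∫ u in Ioi (0 : ℝ),
        Real.exp (-u ^ 2 / (2 * T)) * (√2 * Real.cosh (u / 2) * (π / 2)))) := by
    refine tendsto_integral_filter_of_dominated_convergence
      (fun u => C * (Real.exp (-u ^ 2 / (2 * T)) * Real.exp (3 / 2 * u)))
      (.of_forall fun σ₀ => ?_) ?_
      ((integrable_exp_neg_sq_div_mul_exp hT _).const_mul C).integrableOn ?_
    · have hc : Continuous fun u : ℝ => Real.exp (-u ^ 2 / (2 * T)) := by fun_prop
      exact hc.aestronglyMeasurable.mul (aestronglyMeasurable_sabrPayoff σ₀)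
    · filter_upwards [eventually_ge_atTop 0] with σ₀ hσ
      filter_upwards [ae_restrict_mem measurableSet_Ioi] with u hu
      rw [norm_mul, Real.norm_eq_abs, Real.abs_exp, mul_left_comm]
      gcongr
      exact hC σ₀ u hσ hu
    · filter_upwards [ae_restrict_mem measurableSet_Ioi] with u hu
      exact (tendsto_sabrPayoff hu).const_mul _
  have hval : ∫ u in Ioi (0 : ℝ),
        Real.exp (-u ^ 2 / (2 * T)) * (√2 * Real.cosh (u / 2) * (π / 2)) =
      √2 * (π / 2) * (√(2 * π * T) / 2 * Real.exp (T / 8)) := by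
    have := integral_exp_neg_sq_div_mul_cosh hT (1 / 2)
    rw [show (1 / 2 : ℝ) ^ 2 * T / 2 = T / 8 by ring] at this
    rw [← this, ← integral_const_mul]
    congr 1
    funext u
    rw [one_div_mul_eq_div]
    ring
  have hpi := Real.pi_pos
  have hpow : π ^ (3 / 2 : ℝ) = π * √π := by
    rw [show (3 / 2 : ℝ) = 1 + 1 / 2 by norm_num, Real.rpow_add hpi, Real.rpow_one,
      Real.sqrt_eq_rpow]
  have hone : 2 * Real.exp (-T / 8) / (π ^ (3 / 2 : ℝ) * √T) *
      (√2 * (π / 2) * (√(2 * π * T) / 2 * Real.exp (T / 8))) = 1 := by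
    have hexp : Real.exp (-(T / 8)) * Real.exp (T / 8) = 1 := by
      rw [← Real.exp_add, neg_add_cancel, Real.exp_zero]
    have h2 : √(2 : ℝ) * √2 = 2 := Real.mul_self_sqrt two_pos.le
    rw [hpow, Real.sqrt_mul (by positivity), Real.sqrt_mul two_pos.le]
    have h3 : 0 < √π := Real.sqrt_pos.2 hpi
    have h4 : 0 < √T := Real.sqrt_pos.2 hT
    field_simp
    linear_combination (√2 * √2) * hexp + h2
  rw [← hone, ← hval]
  exact hlim.const_mul _
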